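/- arXiv:1307.0071 — 2 statements merged into one kernel-verified Lean document; each statement's English description precedes it below -/
import Mathlib

section
/- Let B₀, B₁ ⊆ ℝ^d be polytopes, let F₀ be a nonempty face of B₀ and F₁ a nonempty face of B₁, and let P = conv((B₀ × {0}) ∪ (B₁ × {1})) ⊆ ℝ^{d+1}. Then conv((F₀ × {0}) ∪ (F₁ × {1})) is a face of P if and only if relint(ncone(B₀, F₀)) ∩ relint(ncone(B₁, F₁)) ≠ ∅. -/
open RealInnerProductSpace

/-- A polytope is the convex hull of a finite set of points. -/
def IsPolytope {n : ℕ} (P : Set (EuclideanSpace ℝ (Fin n))) : Prop :=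
  ∃ S : Finset (EuclideanSpace ℝ (Fin n)), P = convexHull ℝ (S : Set (EuclideanSpace ℝ (Fin n)))

/-- An (exposed) face of `P`: a set of the form `{x ∈ P | ∀ y ∈ P, ⟪c, y⟫ ≤ ⟪c, x⟫}`. -/
def IsFace {n : ℕ} (P F : Set (EuclideanSpace ℝ (Fin n))) : Prop :=
  ∃ c : EuclideanSpace ℝ (Fin n), F = {x ∈ P | ∀ y ∈ P, ⟪c, y⟫ ≤ ⟪c, x⟫}

/-- The normal cone of a face `F` of a polytope `P`. -/
def ncone {n : ℕ} (P F : Set (EuclideanSpace ℝ (Fin n))) : Set (EuclideanSpace ℝ (Fin n)) :=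
  {y | ∀ p ∈ P, ∀ f ∈ F, ⟪y, p⟫ ≤ ⟪y, f⟫}

/-- An (exposed) face of a subset of `ℝ^d × ℝ ≅ ℝ^{d+1}`, with the linear functional
written as `(x, t) ↦ ⟪c, x⟫ + γ * t`. -/
def IsFaceProd {d : ℕ} (P F : Set (EuclideanSpace ℝ (Fin d) × ℝ)) : Prop :=
  ∃ (c : EuclideanSpace ℝ (Fin d)) (γ : ℝ),
    F = {x ∈ P | ∀ y ∈ P, ⟪c, y.1⟫ + γ * y.2 ≤ ⟪c, x.1⟫ + γ * x.2}

lemma IsFace.subset {n : ℕ} {P F : Set (EuclideanSpace ℝ (Fin n))} (hF : IsFace P F) : F ⊆ P := by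
  obtain ⟨c, rfl⟩ := hF
  exact fun x hx => hx.1

lemma IsFace.convex {n : ℕ} {P F : Set (EuclideanSpace ℝ (Fin n))} (hP : Convex ℝ P)
    (hF : IsFace P F) : Convex ℝ F := by
  obtain ⟨c, rfl⟩ := hF
  intro x hx y hy a b ha hb hab
  refine ⟨hP hx.1 hy.1 ha hb hab, fun z hz => ?_⟩
  have h1 := mul_le_mul_of_nonneg_left (hx.2 z hz) ha
  have h2 := mul_le_mul_of_nonneg_left (hy.2 z hz) hb
  rw [inner_add_right, inner_smul_right, inner_smul_right]
  calc ⟪c, z⟫ = a * ⟪c, z⟫ + b * ⟪c, z⟫ := by rw [← add_mul, hab, one_mul]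
    _ ≤ _ := add_le_add h1 h2

lemma IsPolytope.convex {n : ℕ} {P : Set (EuclideanSpace ℝ (Fin n))} (hP : IsPolytope P) :
    Convex ℝ P := by
  obtain ⟨S, rfl⟩ := hP
  exact convex_convexHull ℝ _

/-- A linear functional bounded by `M` on `A` attains `M` on `convexHull ℝ A` only in the convex
hull of the points of `A` where it attains `M`. -/
lemma mem_convexHull_level_of_le {E : Type*} [AddCommGroup E] [Module ℝ E] {A : Set E}
    (φ : E →ₗ[ℝ] ℝ) {M : ℝ} (hA : ∀ x ∈ A, φ x ≤ M) {x : E} (hx : x ∈ convexHull ℝ A) :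
    φ x ≤ M ∧ (φ x = M → x ∈ convexHull ℝ {x ∈ A | φ x = M}) := by
  have hsub : A ⊆ {x | φ x ≤ M ∧ (φ x = M → x ∈ convexHull ℝ {x ∈ A | φ x = M})} :=
    fun y hy => ⟨hA y hy, fun h => subset_convexHull ℝ _ ⟨hy, h⟩⟩
  refine convexHull_min hsub ?_ hx
  rintro y ⟨hy, hy'⟩ z ⟨hz, hz'⟩ a b ha hb hab
  have h1 := mul_le_mul_of_nonneg_left hy ha
  have h2 := mul_le_mul_of_nonneg_left hz hb
  have hM : a * M + b * M = M := by rw [← add_mul, hab, one_mul]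
  simp only [Set.mem_ofPred_eq, map_add, map_smul, smul_eq_mul]
  refine ⟨by linarith, fun h => ?_⟩
  rcases ha.eq_or_lt with rfl | ha'
  · obtain rfl : b = 1 := by linarith
    simpa using hz' (by linarith)
  rcases hb.eq_or_lt with rfl | hb'
  · obtain rfl : a = 1 := by linarith
    simpa using hy' (by linarith)
  exact convex_convexHull ℝ _
    (hy' (mul_left_cancel₀ ha'.ne' (by linarith))) (hz' (mul_left_cancel₀ hb'.ne' (by linarith)))
    ha hb hab

lemma exists_add_smul_mem_of_mem_intrinsicInterior {E : Type*} [NormedAddCommGroup E]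
    [NormedSpace ℝ E] {N : Set E} {y c : E} (hy : y ∈ intrinsicInterior ℝ N) (hc : c ∈ N) :
    ∃ ε : ℝ, 0 < ε ∧ y + ε • (y - c) ∈ N := by
  have hyN : y ∈ N := intrinsicInterior_subset hy
  obtain ⟨y', hy', rfl⟩ := mem_intrinsicInterior.1 hy
  have hmem : ∀ ε : ℝ, (y' : E) + ε • ((y' : E) - c) ∈ affineSpan ℝ N := fun ε => by
    have h := AffineMap.lineMap_mem (-ε) (subset_affineSpan ℝ N hyN) (subset_affineSpan ℝ N hc)
    convert h using 1
    rw [AffineMap.lineMap_apply_module']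
    module
  let g : ℝ → affineSpan ℝ N := fun ε => ⟨(y' : E) + ε • ((y' : E) - c), hmem ε⟩
  have hg : Continuous g := by
    refine Continuous.subtype_mk ?_ _
    fun_prop
  have hg0 : g 0 = y' := by
    ext
    simp [g]
  have hev : ∀ᶠ ε in nhds (0 : ℝ), g ε ∈ ((↑) ⁻¹' N : Set (affineSpan ℝ N)) := by
    have h := hg.tendsto 0
    rw [hg0] at h
    exact h (mem_interior_iff_mem_nhds.1 hy')
  obtain ⟨δ, hδ, h⟩ := Metric.eventually_nhds_iff.1 hev
  exact ⟨δ / 2, by positivity, h (by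
    rw [Real.dist_eq, sub_zero, abs_of_pos (by positivity)]; linarith)⟩

/-- The relative interior of the normal cone of a nonempty face consists of the vectors exposing
that face. -/
lemma mem_intrinsicInterior_ncone_iff {n : ℕ} {P F : Set (EuclideanSpace ℝ (Fin n))}
    (hP : IsPolytope P) (hF : IsFace P F) (hne : F.Nonempty) (y : EuclideanSpace ℝ (Fin n)) :
    y ∈ intrinsicInterior ℝ (ncone P F) ↔ F = {x ∈ P | ∀ z ∈ P, ⟪y, z⟫ ≤ ⟪y, x⟫} := by
  obtain ⟨f, hf⟩ := hne
  have hFP := hF.subset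
  constructor
  · intro hy
    obtain ⟨c, hc⟩ := hF
    have hcN : c ∈ ncone P F := by
      intro p hp g hg
      rw [hc] at hg
      exact hg.2 p hp
    have hyN : y ∈ ncone P F := intrinsicInterior_subset hy
    obtain ⟨ε, hε, hmem⟩ := exists_add_smul_mem_of_mem_intrinsicInterior hy hcN
    refine Set.Subset.antisymm (fun x hx => ⟨hFP hx, fun z hz => hyN z hz x hx⟩) ?_
    rintro x ⟨hxP, hx⟩
    have h1 := hmem x hxP f hf
    have h2 := le_antisymm (hx f (hFP hf)) (hyN x hxP f hf)
    simp only [inner_add_left, real_inner_smul_left, inner_sub_left, h2] at h1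
    have h3 : ⟪c, f⟫ ≤ ⟪c, x⟫ := by
      by_contra! h
      nlinarith [mul_pos hε (sub_pos.2 h)]
    rw [hc]
    exact ⟨hxP, fun z hz => (hcN z hz f hf).trans h3⟩
  · intro hy
    obtain ⟨S, rfl⟩ := hP
    have hyN : y ∈ ncone (convexHull ℝ (S : Set (EuclideanSpace ℝ (Fin n)))) F := by
      intro p hp g hg
      rw [hy] at hg
      exact hg.2 p hp
    set N := ncone (convexHull ℝ (S : Set (EuclideanSpace ℝ (Fin n)))) F with hN
    have hspan : ∀ z ∈ affineSpan ℝ N, ∀ g ∈ F, ⟪z, g⟫ = ⟪z, f⟫ := by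
      intro z hz g hg
      have hle : affineSpan ℝ N ≤ (LinearMap.ker (innerₛₗ ℝ (g - f))).toAffineSubspace := by
        refine affineSpan_le.2 fun w hw => ?_
        have := le_antisymm (hw g (hFP hg) f hf) (hw f (hFP hf) g hg)
        simp [real_inner_comm w, this]
      have := hle hz
      simp only [Submodule.mem_toAffineSubspace, LinearMap.mem_ker, innerₛₗ_apply_apply,
        inner_sub_left, sub_eq_zero] at this
      rw [real_inner_comm, this, real_inner_comm]
    refine mem_intrinsicInterior.2 ⟨⟨y, subset_affineSpan ℝ N hyN⟩, ?_, rfl⟩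
    rw [mem_interior_iff_mem_nhds]
    have hopen : ∀ᶠ z : EuclideanSpace ℝ (Fin n) in nhds y,
        ∀ s ∈ S, s ∉ F → ⟪z, s⟫ < ⟪z, f⟫ := by
      refine (Filter.eventually_all_finset S).2 fun s hs => ?_
      by_cases hsF : s ∈ F
      · exact Filter.Eventually.of_forall fun z h => absurd hsF h
      have hsP := subset_convexHull ℝ (S : Set (EuclideanSpace ℝ (Fin n))) hs
      have hlt : ⟪y, s⟫ < ⟪y, f⟫ := by
        by_contra! h
        refine hsF ?_
        rw [hy]
        exact ⟨hsP, fun z hz => (hyN z hz f hf).trans h⟩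
      have hcont : ∀ v : EuclideanSpace ℝ (Fin n), Continuous fun z => ⟪z, v⟫ := fun v => by
        fun_prop
      exact ((hcont s).tendsto y).eventually_lt ((hcont f).tendsto y) hlt |>.mono fun z h _ => h
    filter_upwards [continuous_subtype_val.continuousAt.eventually hopen] with z hz p hp g hg
    rw [hspan z z.2 g hg]
    have hsub : (S : Set (EuclideanSpace ℝ (Fin n))) ⊆
        {p | innerₛₗ ℝ (z : EuclideanSpace ℝ (Fin n)) p ≤ ⟪(z : EuclideanSpace ℝ (Fin n)), f⟫} := by
      intro s hs
      by_cases hsF : s ∈ F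
      · exact (hspan z z.2 s hsF).le
      · exact (hz s hs hsF).le
    exact convexHull_min hsub (convex_halfSpace_le (LinearMap.isLinear _) _) hp

lemma mem_of_mk_zero_mem_convexHull {E : Type*} [AddCommGroup E] [Module ℝ E] {F₀ F₁ : Set E}
    (hF₀ : Convex ℝ F₀) {x : E}
    (hx : (x, (0 : ℝ)) ∈ convexHull ℝ ((F₀ ×ˢ ({0} : Set ℝ)) ∪ (F₁ ×ˢ ({1} : Set ℝ)))) :
    x ∈ F₀ := by
  have h := (mem_convexHull_level_of_le (-LinearMap.snd ℝ E ℝ) (M := 0) (by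
    rintro ⟨p, t⟩ (⟨_, rfl⟩ | ⟨_, rfl⟩) <;> simp) hx).2 (by simp)
  refine (convexHull_min ?_ (hF₀.prod (convex_singleton (0 : ℝ))) h).1
  rintro ⟨p, t⟩ ⟨hp | ⟨_, rfl⟩, ht⟩
  · exact hp
  · simp at ht

lemma mem_of_mk_one_mem_convexHull {E : Type*} [AddCommGroup E] [Module ℝ E] {F₀ F₁ : Set E}
    (hF₁ : Convex ℝ F₁) {x : E}
    (hx : (x, (1 : ℝ)) ∈ convexHull ℝ ((F₀ ×ˢ ({0} : Set ℝ)) ∪ (F₁ ×ˢ ({1} : Set ℝ)))) :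
    x ∈ F₁ := by
  have h := (mem_convexHull_level_of_le (LinearMap.snd ℝ E ℝ) (M := 1) (by
    rintro ⟨p, t⟩ (⟨_, rfl⟩ | ⟨_, rfl⟩) <;> simp) hx).2 (by simp)
  refine (convexHull_min ?_ (hF₁.prod (convex_singleton (1 : ℝ))) h).1
  rintro ⟨p, t⟩ ⟨⟨_, rfl⟩ | hp, ht⟩
  · simp at ht
  · exact hp

theorem stmt_7 {d : ℕ} (B₀ B₁ F₀ F₁ : Set (EuclideanSpace ℝ (Fin d)))
    (hB₀ : IsPolytope B₀) (hB₁ : IsPolytope B₁)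
    (hF₀ : IsFace B₀ F₀) (hF₀ne : F₀.Nonempty)
    (hF₁ : IsFace B₁ F₁) (hF₁ne : F₁.Nonempty) :
    IsFaceProd (convexHull ℝ ((B₀ ×ˢ ({0} : Set ℝ)) ∪ (B₁ ×ˢ ({1} : Set ℝ))))
        (convexHull ℝ ((F₀ ×ˢ ({0} : Set ℝ)) ∪ (F₁ ×ˢ ({1} : Set ℝ)))) ↔
      (intrinsicInterior ℝ (ncone B₀ F₀) ∩ intrinsicInterior ℝ (ncone B₁ F₁)).Nonempty := by
  have memB₀ : ∀ x ∈ B₀, (x, (0 : ℝ)) ∈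
      convexHull ℝ ((B₀ ×ˢ ({0} : Set ℝ)) ∪ (B₁ ×ˢ ({1} : Set ℝ))) :=
    fun x hx => subset_convexHull ℝ _ (Or.inl ⟨hx, rfl⟩)
  have memB₁ : ∀ x ∈ B₁, (x, (1 : ℝ)) ∈
      convexHull ℝ ((B₀ ×ˢ ({0} : Set ℝ)) ∪ (B₁ ×ˢ ({1} : Set ℝ))) :=
    fun x hx => subset_convexHull ℝ _ (Or.inr ⟨hx, rfl⟩)
  have memF₀ : ∀ x ∈ F₀, (x, (0 : ℝ)) ∈
      convexHull ℝ ((F₀ ×ˢ ({0} : Set ℝ)) ∪ (F₁ ×ˢ ({1} : Set ℝ))) :=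
    fun x hx => subset_convexHull ℝ _ (Or.inl ⟨hx, rfl⟩)
  have memF₁ : ∀ x ∈ F₁, (x, (1 : ℝ)) ∈
      convexHull ℝ ((F₀ ×ˢ ({0} : Set ℝ)) ∪ (F₁ ×ˢ ({1} : Set ℝ))) :=
    fun x hx => subset_convexHull ℝ _ (Or.inr ⟨hx, rfl⟩)
  have hsub := convexHull_mono (𝕜 := ℝ) (Set.union_subset_union
    (Set.prod_mono_left (t := ({0} : Set ℝ)) hF₀.subset)
    (Set.prod_mono_left (t := ({1} : Set ℝ)) hF₁.subset))
  obtain ⟨f₀, hf₀⟩ := id hF₀ne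
  obtain ⟨f₁, hf₁⟩ := id hF₁ne
  constructor
  · rintro ⟨c, γ, h⟩
    refine ⟨c, (mem_intrinsicInterior_ncone_iff hB₀ hF₀ hF₀ne c).2 ?_,
      (mem_intrinsicInterior_ncone_iff hB₁ hF₁ hF₁ne c).2 ?_⟩
    · refine Set.Subset.antisymm (fun x hx => ⟨hF₀.subset hx, fun z hz => ?_⟩) ?_
      · have hx' := memF₀ x hx
        rw [h] at hx'
        simpa using hx'.2 _ (memB₀ z hz)
      · rintro x ⟨hx, hmax⟩
        refine mem_of_mk_zero_mem_convexHull (F₁ := F₁) (hF₀.convex hB₀.convex) ?_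
        have hf := memF₀ f₀ hf₀
        rw [h] at hf ⊢
        refine ⟨memB₀ x hx, fun y hy => (hf.2 y hy).trans ?_⟩
        simpa using hmax f₀ (hF₀.subset hf₀)
    · refine Set.Subset.antisymm (fun x hx => ⟨hF₁.subset hx, fun z hz => ?_⟩) ?_
      · have hx' := memF₁ x hx
        rw [h] at hx'
        simpa using hx'.2 _ (memB₁ z hz)
      · rintro x ⟨hx, hmax⟩
        refine mem_of_mk_one_mem_convexHull (F₀ := F₀) (hF₁.convex hB₁.convex) ?_
        have hf := memF₁ f₁ hf₁
        rw [h] at hf ⊢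
        refine ⟨memB₁ x hx, fun y hy => (hf.2 y hy).trans ?_⟩
        simpa using hmax f₁ (hF₁.subset hf₁)
  · rintro ⟨c, hc₀, hc₁⟩
    have hN₀ : c ∈ ncone B₀ F₀ := intrinsicInterior_subset hc₀
    have hN₁ : c ∈ ncone B₁ F₁ := intrinsicInterior_subset hc₁
    rw [mem_intrinsicInterior_ncone_iff hB₀ hF₀ hF₀ne] at hc₀
    rw [mem_intrinsicInterior_ncone_iff hB₁ hF₁ hF₁ne] at hc₁
    let φ : EuclideanSpace ℝ (Fin d) × ℝ →ₗ[ℝ] ℝ :=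
      (innerₛₗ ℝ c).coprod ((⟪c, f₀⟫ - ⟪c, f₁⟫) • LinearMap.id)
    have hφ : ∀ x, φ x = ⟪c, x.1⟫ + (⟪c, f₀⟫ - ⟪c, f₁⟫) * x.2 := fun x => by simp [φ]
    have hle : ∀ x ∈ (B₀ ×ˢ ({0} : Set ℝ)) ∪ (B₁ ×ˢ ({1} : Set ℝ)), φ x ≤ ⟪c, f₀⟫ := by
      rintro ⟨x, t⟩ (⟨hx, rfl⟩ | ⟨hx, rfl⟩)
      · simpa [hφ] using hN₀ x hx f₀ hf₀
      · have := hN₁ x hx f₁ hf₁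
        simp only [hφ]
        linarith
    refine ⟨c, ⟪c, f₀⟫ - ⟪c, f₁⟫, ?_⟩
    simp only [← hφ]
    refine Set.Subset.antisymm (fun x hx => ⟨hsub hx, fun y hy => ?_⟩) ?_
    · refine (mem_convexHull_level_of_le φ hle hy).1.trans ?_
      refine convexHull_min (t := {x | ⟪c, f₀⟫ ≤ φ x}) ?_
        (convex_halfSpace_ge φ.isLinear _) hx
      rintro ⟨x, t⟩ (⟨hx, rfl⟩ | ⟨hx, rfl⟩)
      · simpa [hφ] using hN₀ f₀ (hF₀.subset hf₀) x hx
      · have := hN₁ f₁ (hF₁.subset hf₁) x hx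
        simp only [hφ, Set.mem_ofPred_eq]
        linarith
    · rintro x ⟨hx, hmax⟩
      obtain ⟨hxle, hlevel⟩ := mem_convexHull_level_of_le φ hle hx
      have hge := hmax _ (memB₀ f₀ (hF₀.subset hf₀))
      rw [hφ (f₀, 0)] at hge
      refine convexHull_mono ?_ (hlevel (le_antisymm hxle (by simpa using hge)))
      rintro ⟨p, t⟩ ⟨⟨hp, rfl⟩ | ⟨hp, rfl⟩, hpM⟩ <;> simp only [hφ] at hpM
      · refine Or.inl ⟨?_, rfl⟩
        rw [hc₀]
        exact ⟨hp, fun z hz => (hN₀ z hz f₀ hf₀).trans (by linarith)⟩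
      · refine Or.inr ⟨?_, rfl⟩
        rw [hc₁]
        exact ⟨hp, fun z hz => (hN₁ z hz f₁ hf₁).trans (by linarith)⟩
end

section
/- Let P ⊆ ℝ^n be a polytope with 0 in its interior. If P is perfectly centered, then its polar P* is perfectly centered. -/
open RealInnerProductSpace

/-- The polar of a set `P ⊆ ℝⁿ`: `P* = {y | ∀ x ∈ P, ⟪x, y⟫ ≤ 1}`. -/
def polarSet {n : ℕ} (P : Set (EuclideanSpace ℝ (Fin n))) : Set (EuclideanSpace ℝ (Fin n)) :=
  {y | ∀ x ∈ P, ⟪x, y⟫ ≤ 1}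

/-- A polytope is perfectly centered if for each nonempty face `F`, the orthogonal
projection of the origin onto the affine span of `F` lies in the relative interior of `F`. -/
def PerfectlyCentered {n : ℕ} (P : Set (EuclideanSpace ℝ (Fin n))) : Prop :=
  ∀ F, IsFace P F → F.Nonempty →
    ∃ p ∈ intrinsicInterior ℝ F, ∀ x ∈ affineSpan ℝ F, ⟪x - p, p⟫ = 0

/-- A point of a set that has a neighbourhood whose trace on the affine span lies in the set
is in the intrinsic interior. -/
theorem mem_intrinsicInterior_of_nhds {E : Type*} [NormedAddCommGroup E] [NormedSpace ℝ E]
    {K U : Set E} {q : E} (hq : q ∈ K) (hU : U ∈ nhds q)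
    (h : ∀ y ∈ U, y ∈ affineSpan ℝ K → y ∈ K) : q ∈ intrinsicInterior ℝ K := by
  rw [mem_intrinsicInterior]
  refine ⟨⟨q, subset_affineSpan ℝ K hq⟩, ?_, rfl⟩
  rw [mem_interior_iff_mem_nhds]
  filter_upwards [continuous_subtype_val.continuousAt.preimage_mem_nhds hU] with y hy
  exact h y hy y.2

/-- A linear functional attaining its maximum over `G` at an intrinsic interior point is constant
on `G`. -/
theorem inner_eq_of_mem_intrinsicInterior {E : Type*} [NormedAddCommGroup E]
    [InnerProductSpace ℝ E] {G : Set E} {c p z : E} (hp : p ∈ intrinsicInterior ℝ G)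
    (hmax : ∀ x ∈ G, ⟪c, x⟫ ≤ ⟪c, p⟫) (hz : z ∈ G) : ⟪c, z⟫ = ⟪c, p⟫ := by
  rw [mem_intrinsicInterior] at hp
  obtain ⟨y, hy, rfl⟩ := hp
  refine le_antisymm (hmax z hz) ?_
  let g : ℝ → affineSpan ℝ G := fun t =>
    ⟨AffineMap.lineMap z (y : E) t,
      AffineMap.lineMap_mem t (subset_affineSpan ℝ G hz) y.2⟩
  have hg : Continuous g := by
    refine Continuous.subtype_mk ?_ _
    exact AffineMap.lineMap_continuous
  have hg1 : g 1 = y := Subtype.ext (by simp [g])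
  have hmem : g ⁻¹' ((↑) ⁻¹' G) ∈ nhds (1 : ℝ) :=
    hg.continuousAt.preimage_mem_nhds (by rw [hg1]; exact mem_interior_iff_mem_nhds.1 hy)
  obtain ⟨ε, hε, hball⟩ := Metric.mem_nhds_iff.1 hmem
  have h1 : (1 + ε / 2) ∈ Metric.ball (1 : ℝ) ε := by
    rw [Metric.mem_ball, Real.dist_eq, add_sub_cancel_left, abs_of_pos (by positivity)]
    linarith
  have h2 := hmax _ (hball h1)
  simp only [g, AffineMap.lineMap_apply, vsub_eq_sub, vadd_eq_add, inner_add_right,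
    inner_smul_right, inner_sub_right] at h2
  nlinarith

theorem inner_le_of_mem_convexHull {E : Type*} [NormedAddCommGroup E]
    [InnerProductSpace ℝ E] {S : Set E} {c x : E} {r : ℝ} (h : ∀ v ∈ S, ⟪c, v⟫ ≤ r)
    (hx : x ∈ convexHull ℝ S) : ⟪c, x⟫ ≤ r :=
  convexHull_min (t := {x | ⟪c, x⟫ ≤ r}) h
    (convex_halfSpace_le (innerSL ℝ c).isLinear r) hx

theorem inner_eq_of_mem_affineSpan {E : Type*} [NormedAddCommGroup E]
    [InnerProductSpace ℝ E] {S : Set E} {c x : E} {r : ℝ} (h : ∀ v ∈ S, ⟪c, v⟫ = r)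
    (hx : x ∈ affineSpan ℝ S) : ⟪c, x⟫ = r := by
  refine affineSpan_induction (p := fun x => ⟪c, x⟫ = r) hx h fun t u v w hu hv hw => ?_
  simp only [vsub_eq_sub, vadd_eq_add, inner_add_right, inner_smul_right, inner_sub_right,
    hu, hv, hw, sub_self, mul_zero, zero_add]

/-- In a perfectly centered polytope, the projection of the origin onto a face exposed at level `1`
is an outer normal exposing exactly that face. -/
theorem PerfectlyCentered.inner_lt {n : ℕ} {S : Finset (EuclideanSpace ℝ (Fin n))}
    (hPC : PerfectlyCentered (convexHull ℝ (S : Set (EuclideanSpace ℝ (Fin n)))))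
    {c p : EuclideanSpace ℝ (Fin n)} (hc : ∀ v ∈ S, ⟪c, v⟫ ≤ 1)
    (hp : p ∈ convexHull ℝ (S : Set (EuclideanSpace ℝ (Fin n)))) (hcp : ⟪c, p⟫ = 1)
    (hpF : ∀ x ∈ convexHull ℝ (S : Set (EuclideanSpace ℝ (Fin n))), ⟪c, x⟫ = 1 → ⟪p, x⟫ = ⟪p, p⟫)
    {v : EuclideanSpace ℝ (Fin n)} (hv : v ∈ S) (hcv : ⟪c, v⟫ < 1) : ⟪p, v⟫ < ⟪p, p⟫ := by
  by_contra! hpv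
  obtain ⟨w, hw, hwmax⟩ := (S.filter fun v => ⟪c, v⟫ < 1).exists_max_image
    (fun v => (⟪p, v⟫ - ⟪p, p⟫) / (1 - ⟪c, v⟫)) ⟨v, by simp [hv, hcv]⟩
  set r := (⟪p, w⟫ - ⟪p, p⟫) / (1 - ⟪c, w⟫) with hr
  obtain ⟨hwS, hcw⟩ := Finset.mem_filter.1 hw
  have hr0 : 0 ≤ r :=
    (div_nonneg (sub_nonneg.2 hpv) (sub_pos.2 hcv).le).trans
      (hwmax v (Finset.mem_filter.2 ⟨hv, hcv⟩))
  have hSP := subset_convexHull ℝ (S : Set (EuclideanSpace ℝ (Fin n)))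
  have hle : ∀ u ∈ S, ⟪p + r • c, u⟫ ≤ ⟪p, p⟫ + r := by
    intro u hu
    rw [inner_add_left, real_inner_smul_left]
    rcases (hc u hu).lt_or_eq with h | h
    · have := hwmax u (Finset.mem_filter.2 ⟨hu, h⟩)
      rw [div_le_iff₀ (sub_pos.2 h)] at this
      linarith
    · rw [hpF u (hSP hu) h, h, mul_one]
  have hleP : ∀ x ∈ convexHull ℝ (S : Set (EuclideanSpace ℝ (Fin n))),
      ⟪p + r • c, x⟫ ≤ ⟪p, p⟫ + r := fun x hx => inner_le_of_mem_convexHull hle hx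
  have hpv' : ⟪p + r • c, p⟫ = ⟪p, p⟫ + r := by
    rw [inner_add_left, real_inner_smul_left, hcp, mul_one]
  have hwv : ⟪p + r • c, w⟫ = ⟪p, p⟫ + r := by
    have : r * (1 - ⟪c, w⟫) = ⟪p, w⟫ - ⟪p, p⟫ := div_mul_cancel₀ _ (sub_pos.2 hcw).ne'
    rw [inner_add_left, real_inner_smul_left]
    linarith
  have hpG : p ∈ {x ∈ convexHull ℝ (S : Set (EuclideanSpace ℝ (Fin n))) |
      ∀ y ∈ convexHull ℝ (S : Set (EuclideanSpace ℝ (Fin n))),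
        ⟪p + r • c, y⟫ ≤ ⟪p + r • c, x⟫} := ⟨hp, fun y hy => hpv' ▸ hleP y hy⟩
  obtain ⟨g, hg, hgorth⟩ := hPC _ ⟨p + r • c, rfl⟩ ⟨p, hpG⟩
  have hgG := intrinsicInterior_subset hg
  have h1 : ⟪p, p⟫ + r ≤ ⟪p, g⟫ + r * ⟪c, g⟫ := by
    have := hgG.2 p hp
    rwa [hpv', inner_add_left, real_inner_smul_left] at this
  have h2 : ⟪c, g⟫ ≤ 1 := inner_le_of_mem_convexHull hc hgG.1
  have h3 := hgorth p (subset_affineSpan ℝ _ hpG)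
  have h4 : p - g = 0 := by
    rw [← real_inner_self_nonpos]
    simp only [inner_sub_left, inner_sub_right] at h3 ⊢
    rw [real_inner_comm p g]
    nlinarith
  obtain rfl := sub_eq_zero.1 h4
  have h5 : ⟪c, w⟫ = ⟪c, p⟫ := inner_eq_of_mem_intrinsicInterior hg
    (fun x hx => hcp ▸ inner_le_of_mem_convexHull hc hx.1)
    ⟨hSP hwS, fun y hy => hwv ▸ hleP y hy⟩
  linarith

/-- A point of the bipolar of a closed convex set containing the origin lies in the set. -/
theorem mem_of_forall_polarSet {n : ℕ} {P : Set (EuclideanSpace ℝ (Fin n))}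
    (hconv : Convex ℝ P) (hclosed : IsClosed P) (h0 : 0 ∈ P) {x : EuclideanSpace ℝ (Fin n)}
    (hx : ∀ y ∈ polarSet P, ⟪x, y⟫ ≤ 1) : x ∈ P := by
  by_contra hxP
  obtain ⟨f, u, hfu, hux⟩ := geometric_hahn_banach_closed_point hconv hclosed hxP
  have hu : 0 < u := by simpa using hfu 0 h0
  obtain ⟨z, rfl⟩ := (InnerProductSpace.toDual ℝ (EuclideanSpace ℝ (Fin n))).surjective f
  simp only [InnerProductSpace.toDual_apply_apply] at hfu hux
  have h1 := hx (u⁻¹ • z) fun a ha => by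
    rw [real_inner_smul_right, real_inner_comm, inv_mul_le_iff₀ hu, mul_one]
    exact (hfu a ha).le
  rw [real_inner_smul_right, real_inner_comm, inv_mul_le_iff₀ hu, mul_one] at h1
  linarith

theorem mem_polarSet_convexHull {n : ℕ} {S : Set (EuclideanSpace ℝ (Fin n))}
    {y : EuclideanSpace ℝ (Fin n)} :
    y ∈ polarSet (convexHull ℝ S) ↔ ∀ v ∈ S, ⟪y, v⟫ ≤ 1 := by
  refine ⟨fun h v hv => ?_, fun h x hx => ?_⟩
  · rw [real_inner_comm]
    exact h v (subset_convexHull ℝ S hv)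
  · rw [real_inner_comm]
    exact inner_le_of_mem_convexHull h hx

theorem convex_polarSet {n : ℕ} (P : Set (EuclideanSpace ℝ (Fin n))) :
    Convex ℝ (polarSet P) := by
  have : polarSet P = ⋂ x ∈ P, {y | ⟪x, y⟫ ≤ 1} := by ext; simp [polarSet]
  rw [this]
  exact convex_iInter₂ fun x _ => convex_halfSpace_le (innerSL ℝ x).isLinear 1

theorem setOf_forall_inner_lt_mem_nhds {E : Type*} [NormedAddCommGroup E]
    [InnerProductSpace ℝ E] (T : Finset E) {q : E} (hq : ∀ v ∈ T, ⟪q, v⟫ < 1) :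
    {y | ∀ v ∈ T, ⟪y, v⟫ < 1} ∈ nhds q := by
  have h : ∀ v ∈ T, ∀ᶠ y in nhds q, ⟪y, v⟫ < 1 := fun v hv =>
    (continuous_id.inner continuous_const).continuousAt.eventually_lt_const (hq v hv)
  exact (Filter.eventually_all_finset T).2 h

theorem stmt_11 {n : ℕ} (P : Set (EuclideanSpace ℝ (Fin n)))
    (hP : IsPolytope P) (h0 : (0 : EuclideanSpace ℝ (Fin n)) ∈ interior P)
    (hPC : PerfectlyCentered P) :
    PerfectlyCentered (polarSet P) := by
  obtain ⟨S, rfl⟩ := hP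
  have h0P := interior_subset h0
  set P := convexHull ℝ (S : Set (EuclideanSpace ℝ (Fin n))) with hPdef
  have hSP : (S : Set (EuclideanSpace ℝ (Fin n))) ⊆ P := subset_convexHull ℝ _
  have h0polar : (0 : EuclideanSpace ℝ (Fin n)) ∈ polarSet P := fun x _ => by simp
  have hnhds : polarSet P ∈ nhds (0 : EuclideanSpace ℝ (Fin n)) := by
    filter_upwards [setOf_forall_inner_lt_mem_nhds S (q := 0) (by simp)] with y hy
    exact mem_polarSet_convexHull.2 fun v hv => (hy v hv).le
  rintro K ⟨c, hK⟩ ⟨y₀, hy₀⟩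
  by_cases hc : c = 0
  · have hKP : K = polarSet P := by simp [hK, hc]
    refine ⟨0, ?_, by simp⟩
    rw [hKP]
    exact mem_intrinsicInterior_of_nhds h0polar hnhds fun y hy _ => hy
  have hy₀' := hy₀
  rw [hK] at hy₀'
  obtain ⟨hy₀P, hy₀max⟩ := hy₀'
  have hM : 0 < ⟪c, y₀⟫ := by
    have ht : Filter.Tendsto (fun t : ℝ => t • c) (nhds 0) (nhds 0) :=
      Continuous.tendsto' (by fun_prop) _ _ (zero_smul ℝ c)
    obtain ⟨ε, hε, hball⟩ := Metric.mem_nhds_iff.1 (ht hnhds)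
    have h1 : ε / 2 ∈ Metric.ball (0 : ℝ) ε := by
      rw [Metric.mem_ball, Real.dist_eq, sub_zero, abs_of_pos (by positivity)]
      linarith
    refine lt_of_lt_of_le ?_ (hy₀max _ (hball h1))
    rw [real_inner_smul_right]
    exact mul_pos (by positivity) (real_inner_self_pos.2 hc)
  set x₀ := (⟪c, y₀⟫)⁻¹ • c with hx₀
  have hx₀P : x₀ ∈ P := by
    refine mem_of_forall_polarSet (convex_convexHull ℝ _)
      (S.finite_toSet.isCompact_convexHull ℝ).isClosed h0P fun y hy => ?_
    rw [hx₀, real_inner_smul_left, inv_mul_le_iff₀ hM, mul_one]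
    exact hy₀max y hy
  have hKiff : ∀ y, y ∈ K ↔ y ∈ polarSet P ∧ ⟪x₀, y⟫ = 1 := by
    intro y
    rw [hK, hx₀, real_inner_smul_left, inv_mul_eq_one₀ hM.ne']
    exact ⟨fun h => ⟨h.1, le_antisymm (h.2 _ hy₀P) (hy₀max y h.1)⟩,
      fun h => ⟨h.1, fun z hz => h.2 ▸ hy₀max z hz⟩⟩
  have hKconv : Convex ℝ K := by
    have : K = polarSet P ∩ {y | ⟪x₀, y⟫ = 1} := Set.ext hKiff
    rw [this]
    exact (convex_polarSet P).inter (convex_hyperplane (innerSL ℝ x₀).isLinear 1)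
  obtain ⟨y₁, hy₁⟩ := Set.Nonempty.intrinsicInterior hKconv ⟨y₀, hy₀⟩
  obtain ⟨hy₁P, hx₀y₁⟩ := (hKiff y₁).1 (intrinsicInterior_subset hy₁)
  have hconst : ∀ x ∈ P, ⟪y₁, x⟫ = 1 → ∀ y ∈ K, ⟪x, y⟫ = 1 := by
    intro x hx hxy y hy
    rw [real_inner_comm] at hxy
    rw [inner_eq_of_mem_intrinsicInterior hy₁ (fun z hz => ?_) hy, hxy]
    rw [hxy]
    exact ((hKiff z).1 hz).1 x hx
  have hy₁S : ∀ v ∈ S, ⟪y₁, v⟫ ≤ 1 := mem_polarSet_convexHull.1 hy₁P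
  have hy₁le : ∀ x ∈ P, ⟪y₁, x⟫ ≤ 1 := fun x hx => inner_le_of_mem_convexHull hy₁S hx
  have hx₀y₁' : ⟪y₁, x₀⟫ = 1 := by rw [real_inner_comm]; exact hx₀y₁
  obtain ⟨p, hp, hporth⟩ := hPC _ ⟨y₁, rfl⟩ ⟨x₀, hx₀P, fun y hy => hx₀y₁' ▸ hy₁le y hy⟩
  obtain ⟨hpP, hpmax⟩ := intrinsicInterior_subset hp
  have hpy₁ : ⟪y₁, p⟫ = 1 := le_antisymm (hy₁le p hpP) (hx₀y₁' ▸ hpmax x₀ hx₀P)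
  have hpF : ∀ x ∈ P, ⟪y₁, x⟫ = 1 → ⟪p, x⟫ = ⟪p, p⟫ := by
    intro x hx hxy
    have := hporth x (subset_affineSpan ℝ _ ⟨hx, fun y hy => hxy ▸ hy₁le y hy⟩)
    rw [inner_sub_left, real_inner_comm] at this
    linarith
  have hpp : 0 < ⟪p, p⟫ := real_inner_self_pos.2 (by rintro rfl; simp at hpy₁)
  set q := (⟪p, p⟫)⁻¹ • p with hq
  have hqlt : ∀ v ∈ S, ⟪y₁, v⟫ < 1 → ⟪q, v⟫ < 1 := by
    intro v hv hlt
    rw [hq, real_inner_smul_left, inv_mul_lt_iff₀ hpp, mul_one]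
    exact hPC.inner_lt hy₁S hpP hpy₁ hpF hv hlt
  have hqeq : ∀ x ∈ P, ⟪y₁, x⟫ = 1 → ⟪q, x⟫ = 1 := by
    intro x hx hxy
    rw [hq, real_inner_smul_left, hpF x hx hxy, inv_mul_cancel₀ hpp.ne']
  have hqK : q ∈ K := by
    refine (hKiff q).2 ⟨mem_polarSet_convexHull.2 fun v hv => ?_, ?_⟩
    · rcases (hy₁S v hv).lt_or_eq with h | h
      · exact (hqlt v hv h).le
      · exact (hqeq v (hSP hv) h).le
    · rw [real_inner_comm]
      exact hqeq x₀ hx₀P hx₀y₁'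
  refine ⟨q, ?_, fun y hy => ?_⟩
  · refine mem_intrinsicInterior_of_nhds hqK
      (setOf_forall_inner_lt_mem_nhds (S.filter fun v => ⟪y₁, v⟫ < 1) fun v hv =>
        hqlt v (Finset.mem_filter.1 hv).1 (Finset.mem_filter.1 hv).2) fun y hyU hy => ?_
    refine (hKiff y).2 ⟨mem_polarSet_convexHull.2 fun v hv => ?_,
      inner_eq_of_mem_affineSpan (fun z hz => ((hKiff z).1 hz).2) hy⟩
    rcases (hy₁S v hv).lt_or_eq with h | h
    · exact (hyU v (Finset.mem_filter.2 ⟨hv, h⟩)).le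
    · rw [real_inner_comm]
      exact (inner_eq_of_mem_affineSpan (hconst v (hSP hv) h) hy).le
  · have h1 : ⟪p, y⟫ = 1 := inner_eq_of_mem_affineSpan (hconst p hpP hpy₁) hy
    have h2 : ⟪p, q⟫ = 1 := hconst p hpP hpy₁ q hqK
    have h3 : ⟪p, y - q⟫ = 0 := by rw [inner_sub_right, h1, h2, sub_self]
    rw [real_inner_comm, hq, real_inner_smul_left, ← hq, h3, mul_zero]
end
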